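/- arXiv:1506.05694 — 2 statements merged into one kernel-verified Lean document; each statement's English description precedes it below -/
import Mathlib

section
/- Let ρ : ℝ → [0,1] be a smooth, symmetric (ρ(−x) = ρ(x)), compactly supported function. Then there exists a constant C = C(ρ) such that for all real M₁, M₂ ≥ 1, all c₁, c₂ ∈ ℝ, all ψ₁, ψ₂ ∈ ℝ, and every integer N: |∑_{(k₁,k₂) ∈ ℤ²} ρ((k₁ − c₁)/M₁) ρ((k₂ − c₂)/M₂) e(k₁ψ₁ + k₂ψ₂) e(√2 (k₁² + (N − k₁ − k₂)²))| ≤ C √(M₁ M₂). -/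
/-- `e(θ) = e^{2πiθ}`. -/
noncomputable def eC (θ : ℝ) : ℂ := Complex.exp (2 * Real.pi * Complex.I * θ)

open Finset

lemma eC_add (x y : ℝ) : eC (x + y) = eC x * eC y := by
  simp only [eC, ← Complex.exp_add]
  push_cast
  ring_nf

lemma eC_zero : eC 0 = 1 := by simp [eC]

lemma norm_eC (x : ℝ) : ‖eC x‖ = 1 := by
  rw [eC, show (2 * Real.pi * Complex.I * x : ℂ) = ((2 * Real.pi * x : ℝ) : ℂ) * Complex.I by
    push_cast; ring]
  exact Complex.norm_exp_ofReal_mul_I _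

lemma eC_intCast (n : ℤ) : eC n = 1 := by
  rw [eC, Complex.exp_eq_one_iff]
  exact ⟨n, by push_cast; ring⟩

lemma conj_eC (x : ℝ) : (starRingEnd ℂ) (eC x) = eC (-x) := by
  rw [eC, eC, ← Complex.exp_conj]
  simp [Complex.conj_ofNat]

lemma four_mul_abs_sub_round_le_norm_eC_sub_one (θ : ℝ) :
    4 * |θ - round θ| ≤ ‖eC θ - 1‖ := by
  set t := θ - round θ with ht
  have h1 : eC θ = eC t := by
    have : θ = t + (round θ : ℤ) := by rw [ht]; ring
    rw [this, eC_add, eC_intCast, mul_one]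
  have h2 : eC t = Complex.exp (Complex.I * ((2 * Real.pi * t : ℝ) : ℂ)) := by
    rw [eC]; push_cast; ring_nf
  have ht2 : |t| ≤ 1 / 2 := abs_sub_round θ
  rw [h1, h2, Complex.norm_exp_I_mul_ofReal_sub_one, Real.norm_eq_abs, abs_mul,
    show 2 * Real.pi * t / 2 = Real.pi * t by ring]
  have h3 : |Real.sin (Real.pi * t)| = Real.sin (Real.pi * |t|) := by
    rw [Real.abs_sin_eq_sin_abs_of_abs_le_pi, abs_mul, abs_of_pos Real.pi_pos]
    rw [abs_mul, abs_of_pos Real.pi_pos]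
    nlinarith [Real.pi_pos]
  have h4 := Real.mul_le_sin (x := Real.pi * |t|) (by positivity)
    (by nlinarith [Real.pi_pos])
  have h5 : 2 / Real.pi * (Real.pi * |t|) = 2 * |t| := by
    field_simp
  rw [h3]
  norm_num
  linarith

/-- Summation by parts, twice. -/
lemma norm_tsum_mul_eC_mul_sq_le (u : ℤ → ℝ) (s : Finset ℤ) {D : ℝ} (θ : ℝ)
    (hs : ∀ k, k ∉ s → u (k + 1) = 0 ∧ u k = 0 ∧ u (k - 1) = 0)
    (hD : ∀ k, |u (k + 1) - 2 * u k + u (k - 1)| ≤ D) :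
    ‖∑' k : ℤ, (u k : ℂ) * eC (k * θ)‖ * ‖eC θ - 1‖ ^ 2 ≤ #s * D := by
  set T := ∑' k : ℤ, (u k : ℂ) * eC (k * θ) with hT
  have sum0 : Summable fun k : ℤ => (u k : ℂ) * eC (k * θ) :=
    summable_of_ne_finset_zero (s := s) fun k hk => by simp [(hs k hk).2.1]
  have e1 : HasSum (fun k : ℤ => (u (k + 1) : ℂ) * eC (k * θ)) (eC (-θ) * T) := by
    have := ((Equiv.addRight (1 : ℤ)).hasSum_iff.mpr sum0.hasSum).mul_left (eC (-θ))
    refine this.congr_fun fun k => ?_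
    simp only [Function.comp, Equiv.coe_addRight]
    rw [show (k * θ : ℝ) = -θ + ((k + 1 : ℤ) : ℝ) * θ by push_cast; ring, eC_add]
    ring
  have e2 : HasSum (fun k : ℤ => (u (k - 1) : ℂ) * eC (k * θ)) (eC θ * T) := by
    have := ((Equiv.subRight (1 : ℤ)).hasSum_iff.mpr sum0.hasSum).mul_left (eC θ)
    refine this.congr_fun fun k => ?_
    simp only [Function.comp, Equiv.subRight_apply]
    rw [show (k * θ : ℝ) = θ + ((k - 1 : ℤ) : ℝ) * θ by push_cast; ring, eC_add]
    ring
  have e3 := (e1.sub (sum0.hasSum.mul_left 2)).add e2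
  have e4 : ∑ k ∈ s, ((u (k + 1) - 2 * u k + u (k - 1) : ℝ) : ℂ) * eC (k * θ)
      = eC (-θ) * T - 2 * T + eC θ * T := by
    rw [← e3.tsum_eq, tsum_eq_sum (s := s)]
    · refine sum_congr rfl fun k _ => ?_
      push_cast; ring
    · intro k hk
      obtain ⟨h1, h2, h3⟩ := hs k hk
      simp [h1, h2, h3]
  have e5 : eC (-θ) * T - 2 * T + eC θ * T = T * (eC (-θ) * (eC θ - 1) ^ 2) := by
    have : eC (-θ) * eC θ = 1 := by rw [← eC_add, neg_add_cancel, eC_zero]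
    linear_combination (2 * T - T * eC θ) * this
  have e6 : ‖T‖ * ‖eC θ - 1‖ ^ 2 = ‖T * (eC (-θ) * (eC θ - 1) ^ 2)‖ := by
    rw [norm_mul, norm_mul, norm_eC, norm_pow, one_mul]
  rw [e6, ← e5, ← e4, ← nsmul_eq_mul]
  refine norm_sum_le_of_le s (fun k _ => ?_) |>.trans (by rw [sum_const])
  rw [norm_mul, norm_eC, mul_one, Complex.norm_real]
  exact hD k

lemma norm_tsum_mul_eC_le (u : ℤ → ℝ) (s : Finset ℤ) (θ : ℝ)
    (hs : ∀ k, k ∉ s → u k = 0) (hu : ∀ k, |u k| ≤ 1) :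
    ‖∑' k : ℤ, (u k : ℂ) * eC (k * θ)‖ ≤ #s := by
  rw [tsum_eq_sum (s := s) fun k hk => by simp [hs k hk]]
  refine (norm_sum_le_of_le s (f := fun k : ℤ => (u k : ℂ) * eC (k * θ)) (n := fun _ => 1)
    fun k _ => ?_).trans (by simp)
  rw [norm_mul, norm_eC, mul_one, Complex.norm_real]
  exact hu k

lemma exists_second_difference_bound {ρ : ℝ → ℝ} (hsmooth : ContDiff ℝ (⊤ : ℕ∞) ρ)
    (hsupp : HasCompactSupport ρ) :
    ∃ B : ℝ, 0 ≤ B ∧ ∀ x δ, |ρ (x + δ) - 2 * ρ x + ρ (x - δ)| ≤ B * δ ^ 2 := by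
  have hd : ContDiff ℝ 1 (deriv ρ) :=
    (contDiff_succ_iff_deriv (n := 1)).1 (hsmooth.of_le (by norm_cast))
      |>.2.2
  have hdiff : Differentiable ℝ ρ := hsmooth.differentiable (by simp)
  obtain ⟨K, hK⟩ := hd.lipschitzWith_of_hasCompactSupport hsupp.deriv (by simp)
  refine ⟨K, K.2, fun x δ => ?_⟩
  have hg : ∀ y ∈ (Set.univ : Set ℝ), HasDerivWithinAt (fun y => ρ (y + δ) - ρ y)
      (deriv ρ (y + δ) - deriv ρ y) Set.univ y := fun y _ =>
    (((hdiff (y + δ)).hasDerivAt.comp_add_const y δ).sub (hdiff y).hasDerivAt).hasDerivWithinAt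
  have := convex_univ.norm_image_sub_le_of_norm_hasDerivWithin_le (C := K * |δ|) hg
    (fun y _ => by
      have := hK.dist_le_mul (y + δ) y
      simpa [Real.dist_eq] using this) (Set.mem_univ (x - δ)) (Set.mem_univ x)
  simp only [sub_add_cancel, Real.norm_eq_abs, sub_sub_cancel] at this
  calc _ = |ρ (x + δ) - ρ x - (ρ x - ρ (x - δ))| := by ring_nf
    _ ≤ K * |δ| * |δ| := this
    _ = K * δ ^ 2 := by rw [mul_assoc, abs_mul_abs_self, sq]

lemma abs_second_difference_mul_le {a₁ a a₂ b₁ b b₂ A B : ℝ} (ha : |a| ≤ 1) (hb : |b| ≤ 1)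
    (ha₂ : |a₂ - a| ≤ A) (ha₁ : |a₁ - a| ≤ A) (hb₂ : |b₂ - b| ≤ A) (hb₁ : |b₁ - b| ≤ A)
    (hda : |a₂ - 2 * a + a₁| ≤ B) (hdb : |b₂ - 2 * b + b₁| ≤ B) :
    |a₂ * b₂ - 2 * (a * b) + a₁ * b₁| ≤ 2 * B + 2 * A ^ 2 := by
  have hA : 0 ≤ A := (abs_nonneg _).trans ha₂
  have hB : 0 ≤ B := (abs_nonneg _).trans hda
  have key : a₂ * b₂ - 2 * (a * b) + a₁ * b₁ = (a₂ - 2 * a + a₁) * b + (a₂ - a) * (b₂ - b)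
      + (a₁ - a) * (b₁ - b) + a * (b₂ - 2 * b + b₁) := by ring
  have h1 : |(a₂ - 2 * a + a₁) * b| ≤ B * 1 := by rw [abs_mul]; gcongr
  have h2 : |(a₂ - a) * (b₂ - b)| ≤ A * A := by rw [abs_mul]; gcongr
  have h3 : |(a₁ - a) * (b₁ - b)| ≤ A * A := by rw [abs_mul]; gcongr
  have h4 : |a * (b₂ - 2 * b + b₁)| ≤ 1 * B := by rw [abs_mul]; gcongr
  rw [key]
  rw [abs_le] at *
  constructor <;> nlinarith

/-- Fejér-type weight attached to the distance from `θ` to the nearest integer. -/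
noncomputable def roundWeight (M θ : ℝ) : ℝ := 1 / (1 + (M * (θ - round θ)) ^ 2)

lemma roundWeight_nonneg (M θ : ℝ) : 0 ≤ roundWeight M θ := by
  unfold roundWeight; positivity

lemma exists_correlation_sum_bound {ρ : ℝ → ℝ} (hsmooth : ContDiff ℝ (⊤ : ℕ∞) ρ)
    (hsupp : HasCompactSupport ρ) (hrange : ∀ x, |ρ x| ≤ 1) {R : ℝ} (hR : 0 ≤ R)
    (hρR : ∀ x, R < |x| → ρ x = 0) :
    ∃ K : ℝ, 0 ≤ K ∧ ∀ M : ℝ, 1 ≤ M → ∀ (c θ : ℝ) (h : ℤ),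
      ‖∑' k : ℤ, ((ρ ((k - c) / M) * ρ (((k + h : ℤ) - c) / M) : ℝ) : ℂ) * eC (k * θ)‖ ≤
        K * M * roundWeight M θ := by
  obtain ⟨B, hB0, hB⟩ := exists_second_difference_bound hsmooth hsupp
  obtain ⟨A, hA⟩ := (hsmooth.of_le (by norm_cast) :
    ContDiff ℝ 1 ρ).lipschitzWith_of_hasCompactSupport hsupp (by simp)
  refine ⟨(2 * R + 3) * (1 + (2 * B + 2 * A ^ 2) / 16), by positivity, fun M hM c θ h => ?_⟩
  have hM0 : 0 < M := by linarith
  set u : ℤ → ℝ := fun k => ρ ((k - c) / M) * ρ (((k + h : ℤ) - c) / M) with hu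
  set s : Finset ℤ := Finset.Icc ⌈c - R * M - 1⌉ ⌊c + R * M + 1⌋ with hs
  have hzero : ∀ k : ℤ, R * M < |(k : ℝ) - c| → u k = 0 := fun k hk => by
    rw [hu]; dsimp only
    rw [hρR ((k - c) / M), zero_mul]
    rwa [abs_div, abs_of_pos hM0, lt_div_iff₀ hM0]
  have hmem : ∀ k : ℤ, k ∉ s → R * M + 1 < |(k : ℝ) - c| := fun k hk => by
    by_contra! hcon
    rw [abs_le] at hcon
    refine hk (Finset.mem_Icc.2 ⟨Int.ceil_le.2 (by linarith), Int.le_floor.2 (by linarith)⟩)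
  have hs' : ∀ k, k ∉ s → u (k + 1) = 0 ∧ u k = 0 ∧ u (k - 1) = 0 := fun k hk => by
    have := hmem k hk
    refine ⟨hzero _ ?_, hzero _ (by linarith), hzero _ ?_⟩
    · push_cast
      have h2 := abs_sub_abs_le_abs_sub ((k : ℝ) - c) (-1)
      rw [abs_neg, abs_one, show (k : ℝ) - c - -1 = k + 1 - c by ring] at h2
      linarith
    · push_cast
      have h2 := abs_sub_abs_le_abs_sub ((k : ℝ) - c) 1
      rw [abs_one, show (k : ℝ) - c - 1 = k - 1 - c by ring] at h2
      linarith
  have hcard : (#s : ℝ) ≤ (2 * R + 3) * M := by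
    rw [hs, Int.card_Icc]
    have hfl := Int.floor_le (c + R * M + 1)
    have hce := Int.le_ceil (c - R * M - 1)
    have : ((⌊c + R * M + 1⌋ + 1 - ⌈c - R * M - 1⌉ : ℤ) : ℝ) ≤ (2 * R + 3) * M := by
      push_cast; nlinarith
    rw [← Int.cast_natCast, Int.toNat_eq_max, Int.cast_max]
    exact max_le this (by rw [Int.cast_zero]; positivity)
  have hlip : ∀ x y : ℝ, |ρ x - ρ y| ≤ A * |x - y| := fun x y => by
    simpa [Real.dist_eq] using hA.dist_le_mul x y
  have hD : ∀ k, |u (k + 1) - 2 * u k + u (k - 1)| ≤ (2 * B + 2 * A ^ 2) / M ^ 2 := fun k => by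
    have hs1 : ∀ x : ℝ, |ρ (x + 1 / M) - ρ x| ≤ A / M := fun x => by
      have := hlip (x + 1 / M) x
      rwa [add_sub_cancel_left, abs_of_pos (by positivity : 0 < 1 / M), mul_one_div] at this
    have hs2 : ∀ x : ℝ, |ρ (x - 1 / M) - ρ x| ≤ A / M := fun x => by
      have := hlip (x - 1 / M) x
      rwa [sub_sub_cancel_left, abs_neg, abs_of_pos (by positivity : 0 < 1 / M), mul_one_div] at this
    have hs3 : ∀ x : ℝ, |ρ (x + 1 / M) - 2 * ρ x + ρ (x - 1 / M)| ≤ B / M ^ 2 := fun x => by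
      have := hB x (1 / M)
      rwa [one_div_pow, mul_one_div] at this
    have := abs_second_difference_mul_le (hrange ((k - c) / M))
      (hrange (((k + h : ℤ) - c) / M)) (hs1 _) (hs2 _) (hs1 _) (hs2 _) (hs3 _) (hs3 _)
    convert this using 2
    · simp only [hu]
      push_cast
      ring_nf
    · ring
  have hu1 : ∀ k, |u k| ≤ 1 := fun k => by
    simp only [hu, abs_mul]
    exact mul_le_one₀ (hrange _) (abs_nonneg _) (hrange _)
  have b1 := norm_tsum_mul_eC_le u s θ (fun k hk => (hs' k hk).2.1) hu1
  have b2 := norm_tsum_mul_eC_mul_sq_le u s θ hs' hD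
  have b3 := four_mul_abs_sub_round_le_norm_eC_sub_one θ
  set T := ‖∑' k : ℤ, (u k : ℂ) * eC (k * θ)‖
  set t := θ - round θ
  have hT0 : 0 ≤ T := norm_nonneg _
  have b4 : T * (16 * t ^ 2) ≤ (2 * R + 3) * M * ((2 * B + 2 * A ^ 2) / M ^ 2) := by
    calc T * (16 * t ^ 2) = T * (4 * |t|) ^ 2 := by rw [mul_pow, sq_abs]; ring
      _ ≤ T * ‖eC θ - 1‖ ^ 2 := by gcongr
      _ ≤ _ := b2
      _ ≤ _ := by gcongr
  rw [roundWeight, mul_one_div, le_div_iff₀ (by positivity)]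
  have b5 : T * (M * t) ^ 2 ≤ (2 * R + 3) * M * ((2 * B + 2 * A ^ 2) / 16) := by
    have := mul_le_mul_of_nonneg_left b4 (by positivity : 0 ≤ M ^ 2 / 16)
    calc _ = M ^ 2 / 16 * (T * (16 * t ^ 2)) := by ring
      _ ≤ _ := this
      _ = _ := by field_simp
  have b6 := b1.trans hcard
  linarith

/-- `2√2` is badly approximable. -/
lemma one_le_seven_mul_abs_two_sqrt_two_mul_sub {j : ℤ} (hj : j ≠ 0) (m : ℤ) :
    1 ≤ 7 * |(j : ℝ)| * |2 * √2 * j - m| := by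
  have hj1 : (1 : ℝ) ≤ |(j : ℝ)| := by exact_mod_cast Int.one_le_abs hj
  rcases le_or_gt 1 |2 * √2 * j - m| with h | h
  · nlinarith
  have hsq : √2 ^ 2 = (2 : ℝ) := Real.sq_sqrt (by norm_num)
  have hne : 8 * j ^ 2 - m ^ 2 ≠ 0 := by
    intro h0
    have h0' : (8 * j ^ 2 - m ^ 2 : ℝ) = 0 := by exact_mod_cast h0
    have hjr : (j : ℝ) ≠ 0 := by exact_mod_cast hj
    have : (2 * √2 * j : ℝ) ^ 2 = (m : ℝ) ^ 2 := by
      rw [mul_pow, mul_pow, hsq]; linarith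
    rcases sq_eq_sq_iff_eq_or_eq_neg.1 this with h1 | h1
    · exact irrational_sqrt_two ⟨m / (2 * j), by push_cast; field_simp; linarith⟩
    · exact irrational_sqrt_two ⟨-m / (2 * j), by push_cast; field_simp; linarith⟩
  have h1 : (1 : ℝ) ≤ |2 * √2 * j - m| * |2 * √2 * j + m| := by
    rw [← abs_mul]
    have : (2 * √2 * j - m : ℝ) * (2 * √2 * j + m) = ((8 * j ^ 2 - m ^ 2 : ℤ) : ℝ) := by
      push_cast; linear_combination 4 * (j : ℝ) ^ 2 * hsq
    rw [this]
    exact_mod_cast Int.one_le_abs hne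
  have h2 : |2 * √2 * j + m| ≤ 7 * |(j : ℝ)| := by
    have hs : √2 ≤ 3 / 2 := by rw [Real.sqrt_le_left (by norm_num)]; norm_num
    calc |2 * √2 * j + m| = |4 * √2 * j - (2 * √2 * j - m)| := by ring_nf
      _ ≤ |4 * √2 * j| + |2 * √2 * j - m| := abs_sub _ _
      _ = 4 * √2 * |(j : ℝ)| + |2 * √2 * j - m| := by
        rw [abs_mul, abs_of_nonneg (by positivity : 0 ≤ 4 * √2)]
      _ ≤ 7 * |(j : ℝ)| := by nlinarith
  nlinarith [abs_nonneg (2 * √2 * j - m)]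

lemma summable_one_div_one_add_int_sq : Summable fun n : ℤ => 1 / (1 + (n : ℝ) ^ 2) := by
  refine ((Real.summable_one_div_int_pow (p := 2)).2 one_lt_two).add
    (summable_of_ne_finset_zero (s := {0}) (f := fun n : ℤ => if n = 0 then (1 : ℝ) else 0)
      (by simp)) |>.of_nonneg_of_le (fun n => by positivity) fun n => ?_
  split_ifs with h
  · simp [h]
  · rw [add_zero]
    have : (n : ℝ) ≠ 0 := by exact_mod_cast h
    exact one_div_le_one_div_of_le (by positivity) (by linarith)

/-- Over an injective family of integers of diameter `O(M)`, the numbers `2√2 j` are spaced by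
`≫ 1 / M` modulo one, so that the corresponding weights have bounded sum. -/
lemma exists_sum_roundWeight_le {L : ℝ} (hL : 1 ≤ L) :
    ∃ C : ℝ, 0 ≤ C ∧ ∀ M : ℝ, 1 ≤ M → ∀ {ι : Type} (s : Finset ι) (q : ι → ℤ),
      Set.InjOn q s → (∀ x ∈ s, ∀ y ∈ s, |(q x : ℝ) - q y| ≤ L * M) →
      ∑ x ∈ s, roundWeight M (2 * √2 * q x) ≤ C := by
  refine ⟨3 * (7 * L) ^ 2 * ∑' n : ℤ, 1 / (1 + (n : ℝ) ^ 2),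
    mul_nonneg (by positivity) (tsum_nonneg fun n => by positivity), ?_⟩
  intro M hM ι s q hinj hdiam
  classical
  have hM0 : 0 < M := by linarith
  set t : ι → ℝ := fun x => 2 * √2 * q x - round (2 * √2 * q x : ℝ) with ht
  set n : ι → ℤ := fun x => ⌊7 * L * M * t x⌋ with hn
  have hninj : Set.InjOn n s := by
    intro x hx y hy hxy
    by_contra hne
    have hq : q x - q y ≠ 0 := sub_ne_zero.2 fun h => hne (hinj hx hy h)
    have h1 := one_le_seven_mul_abs_two_sqrt_two_mul_sub hq
      (round (2 * √2 * q x : ℝ) - round (2 * √2 * q y : ℝ))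
    have h2 : 2 * √2 * ((q x - q y : ℤ) : ℝ) -
        ((round (2 * √2 * q x : ℝ) - round (2 * √2 * q y : ℝ) : ℤ) : ℝ) = t x - t y := by
      simp only [ht]; push_cast; ring
    rw [h2] at h1
    have h3 : |((q x - q y : ℤ) : ℝ)| ≤ L * M := by
      push_cast; exact hdiam x hx y hy
    have h4 := Int.abs_sub_lt_one_of_floor_eq_floor hxy
    rw [← mul_sub, abs_mul, abs_of_pos (by positivity)] at h4
    nlinarith [abs_nonneg (t x - t y)]
  have hterm : ∀ x, roundWeight M (2 * √2 * q x) ≤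
      3 * (7 * L) ^ 2 * (1 / (1 + (n x : ℝ) ^ 2)) := by
    intro x
    rw [roundWeight, mul_one_div, div_le_div_iff₀ (by positivity) (by positivity), one_mul]
    change 1 + (n x : ℝ) ^ 2 ≤ 3 * (7 * L) ^ 2 * (1 + (M * t x) ^ 2)
    have f1 := Int.floor_le (7 * L * M * t x)
    have f2 := Int.lt_floor_add_one (7 * L * M * t x)
    change (n x : ℝ) ≤ _ at f1
    change _ < (n x : ℝ) + 1 at f2
    set z := 7 * L * M * t x with hz
    have f3 : (n x : ℝ) ^ 2 ≤ 2 + 2 * z ^ 2 := by nlinarith [sq_nonneg ((n x : ℝ) - 2 * z)]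
    have f4 : (7 * L) ^ 2 * (M * t x) ^ 2 = z ^ 2 := by rw [hz]; ring
    nlinarith [sq_nonneg z]
  calc ∑ x ∈ s, roundWeight M (2 * √2 * q x)
      ≤ ∑ x ∈ s, 3 * (7 * L) ^ 2 * (1 / (1 + (n x : ℝ) ^ 2)) := sum_le_sum fun x _ => hterm x
    _ = 3 * (7 * L) ^ 2 * ∑ m ∈ s.image n, 1 / (1 + (m : ℝ) ^ 2) := by
        rw [sum_image hninj, mul_sum]
    _ ≤ _ := by
        gcongr
        exact summable_one_div_one_add_int_sq.sum_le_tsum _ fun m _ => by positivity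

lemma sum_mul_comp_le_of_fiber_le {ι : Type} (s : Finset ι) (p : ι → ℤ) {f : ℤ → ℝ} {g : ι → ℝ}
    {A B : ℝ} (hB : 0 ≤ B) (hf : ∀ a, 0 ≤ f a) (hA : ∑ a ∈ s.image p, f a ≤ A)
    (hfib : ∀ a, ∑ x ∈ s with p x = a, g x ≤ B) :
    ∑ x ∈ s, f (p x) * g x ≤ A * B := by
  rw [← sum_fiberwise_of_maps_to (t := s.image p) (g := p) fun x hx => mem_image_of_mem p hx]
  calc _ ≤ ∑ a ∈ s.image p, f a * B := by
        refine sum_le_sum fun a _ => ?_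
        rw [sum_congr rfl (g := fun x => f a * g x) fun x hx => by rw [(mem_filter.1 hx).2],
          ← mul_sum]
        exact mul_le_mul_of_nonneg_left (hfib a) (hf a)
    _ = (∑ a ∈ s.image p, f a) * B := by rw [sum_mul]
    _ ≤ A * B := by gcongr

lemma exists_sum_roundWeight_mul_le {R : ℝ} (hR : 1 ≤ R) :
    ∃ C : ℝ, 0 ≤ C ∧ ∀ M₁ M₂ : ℝ, 1 ≤ M₁ → 1 ≤ M₂ → ∀ s : Finset (ℤ × ℤ),
      (∀ h ∈ s, |(h.1 : ℝ)| ≤ R * M₁ ∧ |(h.2 : ℝ)| ≤ R * M₂) →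
      ∑ h ∈ s, roundWeight M₁ (2 * √2 * (2 * h.1 + h.2 : ℤ)) *
        roundWeight M₂ (2 * √2 * (h.1 + h.2 : ℤ)) ≤ C := by
  obtain ⟨C, hC0, hC⟩ := exists_sum_roundWeight_le (L := 6 * R) (by linarith)
  refine ⟨C * C, by positivity, fun M₁ M₂ h₁ h₂ s hs => ?_⟩
  have image_bound : ∀ (M : ℝ) (p : ℤ × ℤ → ℤ), 1 ≤ M →
      (∀ h ∈ s, |(p h : ℝ)| ≤ 3 * R * M) →
      ∑ a ∈ s.image p, roundWeight M (2 * √2 * a) ≤ C := fun M p hM hp => by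
    refine hC M hM (s.image p) id Function.injective_id.injOn fun x hx y hy => ?_
    obtain ⟨v, hv, rfl⟩ := mem_image.1 hx
    obtain ⟨w, hw, rfl⟩ := mem_image.1 hy
    have hv' := hp v hv
    have hw' := hp w hw
    simp only [id]
    rw [abs_le] at *
    constructor <;> linarith
  rcases le_total M₂ M₁ with h | h
  · have himage := image_bound M₁ (fun h => 2 * h.1 + h.2) h₁ fun x hx => by
      obtain ⟨hx1, hx2⟩ := hs x hx
      push_cast
      rw [abs_le] at *
      constructor <;> nlinarith
    have hfiber : ∀ a, ∑ h ∈ s with 2 * h.1 + h.2 = a, roundWeight M₂ (2 * √2 * (h.1 + h.2 : ℤ)) ≤ C := by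
      intro a
      refine hC M₂ h₂ _ (fun h : ℤ × ℤ => h.1 + h.2) ?_ ?_
      · intro x hx y hy hxy
        have e1 := (mem_filter.1 hx).2
        have e2 := (mem_filter.1 hy).2
        simp only at hxy
        ext <;> lia
      · intro x hx y hy
        have e1 := (mem_filter.1 hx).2
        have e2 := (mem_filter.1 hy).2
        have hx' := (hs x (mem_filter.1 hx).1).2
        have hy' := (hs y (mem_filter.1 hy).1).2
        have e3 : (2 * x.1 + x.2 : ℝ) = 2 * y.1 + y.2 := by exact_mod_cast e1.trans e2.symm
        push_cast
        rw [abs_le] at *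
        constructor <;> nlinarith
    exact sum_mul_comp_le_of_fiber_le s (fun h => 2 * h.1 + h.2)
      (f := fun a => roundWeight M₁ (2 * √2 * a)) hC0 (fun a => roundWeight_nonneg _ _)
      himage hfiber
  · simp_rw [mul_comm (roundWeight M₁ _)]
    have himage := image_bound M₂ (fun h => h.1 + h.2) h₂ fun x hx => by
      obtain ⟨hx1, hx2⟩ := hs x hx
      push_cast
      rw [abs_le] at *
      constructor <;> nlinarith
    have hfiber : ∀ a, ∑ h ∈ s with h.1 + h.2 = a, roundWeight M₁ (2 * √2 * (2 * h.1 + h.2 : ℤ)) ≤ C := by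
      intro a
      refine hC M₁ h₁ _ (fun h : ℤ × ℤ => 2 * h.1 + h.2) ?_ ?_
      · intro x hx y hy hxy
        have e1 := (mem_filter.1 hx).2
        have e2 := (mem_filter.1 hy).2
        simp only at hxy
        ext <;> lia
      · intro x hx y hy
        have e1 := (mem_filter.1 hx).2
        have e2 := (mem_filter.1 hy).2
        have hx' := (hs x (mem_filter.1 hx).1).1
        have hy' := (hs y (mem_filter.1 hy).1).1
        have e3 : (x.1 + x.2 : ℝ) = y.1 + y.2 := by exact_mod_cast e1.trans e2.symm
        push_cast
        rw [abs_le] at *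
        constructor <;> nlinarith
    exact sum_mul_comp_le_of_fiber_le s (fun h => h.1 + h.2)
      (f := fun a => roundWeight M₂ (2 * √2 * a)) hC0 (fun a => roundWeight_nonneg _ _)
      himage hfiber

lemma sq_norm_tsum_le_sum_norm_correlation {G : Type*} [AddCommGroup G] (F : G → ℂ)
    (s H : Finset G) (hs : ∀ k ∉ s, F k = 0)
    (hH : ∀ k h, h ∉ H → F (k + h) * (starRingEnd ℂ) (F k) = 0) :
    ‖∑' k, F k‖ ^ 2 ≤ ∑ h ∈ H, ‖∑' k, F (k + h) * (starRingEnd ℂ) (F k)‖ := by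
  have hsum : ∀ h, ∑' k, F (k + h) * (starRingEnd ℂ) (F k) =
      ∑ k ∈ s, F (k + h) * (starRingEnd ℂ) (F k) := fun h =>
    tsum_eq_sum fun k hk => by simp [hs k hk]
  have key : (∑' k, F k) * (starRingEnd ℂ) (∑' k, F k) =
      ∑ h ∈ H, ∑' k, F (k + h) * (starRingEnd ℂ) (F k) := by
    simp_rw [hsum]
    rw [sum_comm]
    have hS : ∑' k, F k = ∑ k ∈ s, F k := tsum_eq_sum hs
    nth_rewrite 2 [hS]
    rw [map_sum, mul_sum]
    refine sum_congr rfl fun k _ => ?_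
    rw [← (Equiv.addLeft k).tsum_eq F,
      ← tsum_mul_right]
    exact tsum_eq_sum fun h hh => hH k h hh
  calc ‖∑' k, F k‖ ^ 2 = ‖(∑' k, F k) * (starRingEnd ℂ) (∑' k, F k)‖ := by
        rw [norm_mul, RCLike.norm_conj, sq]
    _ ≤ _ := by rw [key]; exact norm_sum_le _ _

/-- Lemma 4, estimate (3.17): for a smooth symmetric compactly supported bump
`ρ : ℝ → [0,1]` there is `C = C(ρ)` such that for all `M₁, M₂ ≥ 1`, all centers
`c₁, c₂`, all `ψ₁, ψ₂ ∈ ℝ` and every integer `N`,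
`|∑_{k ∈ ℤ²} ρ((k₁−c₁)/M₁) ρ((k₂−c₂)/M₂) e(k₁ψ₁+k₂ψ₂) e(√2(k₁²+(N−k₁−k₂)²))|
  ≤ C √(M₁M₂)`. -/
theorem mollified_sheared_gauss_sum_bound (ρ : ℝ → ℝ) (hsmooth : ContDiff ℝ (⊤ : ℕ∞) ρ)
    (hsymm : ∀ x, ρ (-x) = ρ x) (hsupp : HasCompactSupport ρ)
    (hrange : ∀ x, ρ x ∈ Set.Icc (0 : ℝ) 1) :
    ∃ C : ℝ, ∀ M₁ M₂ : ℝ, 1 ≤ M₁ → 1 ≤ M₂ → ∀ c₁ c₂ ψ₁ ψ₂ : ℝ, ∀ N : ℤ,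
      ‖∑' k : ℤ × ℤ, (ρ ((k.1 - c₁) / M₁) * ρ ((k.2 - c₂) / M₂) : ℂ) *
          eC (k.1 * ψ₁ + k.2 * ψ₂) *
          eC (Real.sqrt 2 * ((k.1 : ℝ) ^ 2 + ((N : ℝ) - k.1 - k.2) ^ 2))‖ ≤
        C * Real.sqrt (M₁ * M₂) := by
  have habs : ∀ x, |ρ x| ≤ 1 := fun x => by
    rw [abs_of_nonneg (hrange x).1]; exact (hrange x).2
  obtain ⟨R, hR1, hR⟩ : ∃ R : ℝ, 1 ≤ R ∧ ∀ x, R < |x| → ρ x = 0 := by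
    obtain ⟨R, hR⟩ := hsupp.isCompact.isBounded.subset_closedBall 0
    refine ⟨max R 1, le_max_right _ _, fun x hx => ?_⟩
    by_contra hne
    have := hR (subset_tsupport ρ hne)
    rw [mem_closedBall_zero_iff, Real.norm_eq_abs] at this
    exact absurd ((le_max_left R 1).trans_lt hx) (not_lt.2 this)
  obtain ⟨K, hK0, hK⟩ := exists_correlation_sum_bound hsmooth hsupp habs (by linarith) hR
  obtain ⟨C, hC0, hC⟩ := exists_sum_roundWeight_mul_le (R := 2 * R) (by linarith)
  refine ⟨√(K ^ 2 * C), fun M₁ M₂ h₁ h₂ c₁ c₂ ψ₁ ψ₂ N => ?_⟩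
  have hM₁ : 0 < M₁ := by linarith
  have hM₂ : 0 < M₂ := by linarith
  have hzero : ∀ (M c : ℝ) (k : ℤ), 0 < M → R * M < |(k : ℝ) - c| → ρ ((k - c) / M) = 0 :=
    fun M c k hM hk => hR _ (by rwa [abs_div, abs_of_pos hM, lt_div_iff₀ hM])
  have hcorr : ∀ (M c : ℝ) (k h : ℤ), 0 < M → 2 * R * M < |(h : ℝ)| →
      ρ ((k - c) / M) * ρ (((k + h : ℤ) - c) / M) = 0 := fun M c k h hM hh => by
    rcases lt_or_ge (R * M) |(k : ℝ) - c| with hk | hk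
    · rw [hzero M c k hM hk, zero_mul]
    · rw [hzero M c (k + h) hM, mul_zero]
      have := abs_sub_abs_le_abs_sub (h : ℝ) (-((k : ℝ) - c))
      rw [abs_neg, show (h : ℝ) - -(k - c) = (k + h : ℤ) - c by push_cast; ring] at this
      linarith
  set F : ℤ × ℤ → ℂ := fun k => (ρ ((k.1 - c₁) / M₁) * ρ ((k.2 - c₂) / M₂) : ℂ) *
          eC (k.1 * ψ₁ + k.2 * ψ₂) *
          eC (Real.sqrt 2 * ((k.1 : ℝ) ^ 2 + ((N : ℝ) - k.1 - k.2) ^ 2)) with hF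
  set s : Finset (ℤ × ℤ) := Finset.Icc ⌈c₁ - R * M₁⌉ ⌊c₁ + R * M₁⌋ ×ˢ
    Finset.Icc ⌈c₂ - R * M₂⌉ ⌊c₂ + R * M₂⌋ with hs
  set H : Finset (ℤ × ℤ) := Finset.Icc ⌈-(2 * R * M₁)⌉ ⌊2 * R * M₁⌋ ×ˢ
    Finset.Icc ⌈-(2 * R * M₂)⌉ ⌊2 * R * M₂⌋ with hH
  have hmemH : ∀ h, h ∈ H ↔ |(h.1 : ℝ)| ≤ 2 * R * M₁ ∧ |(h.2 : ℝ)| ≤ 2 * R * M₂ := fun h => by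
    simp only [hH, mem_product, Finset.mem_Icc, Int.ceil_le, Int.le_floor, abs_le]
  have hF0 : ∀ k, k ∉ s → F k = 0 := fun k hk => by
    simp only [hs, mem_product, Finset.mem_Icc, Int.ceil_le, Int.le_floor, not_and_or] at hk
    have : R * M₁ < |(k.1 : ℝ) - c₁| ∨ R * M₂ < |(k.2 : ℝ) - c₂| := by
      by_contra! hcon
      simp only [abs_le] at hcon
      rcases hk with (hk | hk) | hk | hk <;> apply hk <;> linarith [hcon.1.1, hcon.2.1]
    rcases this with h | h
    · simp [hF, hzero M₁ c₁ k.1 hM₁ h]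
    · simp [hF, hzero M₂ c₂ k.2 hM₂ h]
  set u : (M c : ℝ) → (h k : ℤ) → ℝ := fun M c h k =>
    ρ ((k - c) / M) * ρ (((k + h : ℤ) - c) / M) with hu
  have hFF : ∀ k h, F (k + h) * (starRingEnd ℂ) (F k) =
      ((u M₁ c₁ h.1 k.1 : ℂ) * eC (k.1 * (2 * √2 * (2 * h.1 + h.2 : ℤ)))) *
      ((u M₂ c₂ h.2 k.2 : ℂ) * eC (k.2 * (2 * √2 * (h.1 + h.2 : ℤ)))) *
      eC (h.1 * ψ₁ + h.2 * ψ₂ + √2 * (h.1 ^ 2 + (h.1 + h.2) ^ 2 - 2 * N * (h.1 + h.2))) := by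
    intro k h
    simp only [hF, hu, map_mul, Complex.conj_ofReal, conj_eC, Prod.fst_add, Prod.snd_add]
    have e : eC (((k.1 + h.1 : ℤ) : ℝ) * ψ₁ + ((k.2 + h.2 : ℤ) : ℝ) * ψ₂) *
        eC (√2 * (((k.1 + h.1 : ℤ) : ℝ) ^ 2 +
          ((N : ℝ) - ((k.1 + h.1 : ℤ) : ℝ) - ((k.2 + h.2 : ℤ) : ℝ)) ^ 2)) *
        (eC (-(k.1 * ψ₁ + k.2 * ψ₂)) *
          eC (-(√2 * ((k.1 : ℝ) ^ 2 + ((N : ℝ) - k.1 - k.2) ^ 2)))) =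
        eC (k.1 * (2 * √2 * (2 * h.1 + h.2 : ℤ))) * eC (k.2 * (2 * √2 * (h.1 + h.2 : ℤ))) *
        eC (h.1 * ψ₁ + h.2 * ψ₂ +
          √2 * (h.1 ^ 2 + (h.1 + h.2) ^ 2 - 2 * N * (h.1 + h.2))) := by
      simp only [← eC_add]
      congr 1
      push_cast
      ring
    push_cast only [Complex.ofReal_mul]
    linear_combination ((ρ ((k.1 - c₁) / M₁) : ℂ) * ρ ((k.2 - c₂) / M₂) *
      ρ (((k.1 + h.1 : ℤ) - c₁) / M₁) * ρ (((k.2 + h.2 : ℤ) - c₂) / M₂)) * e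
  have hH0 : ∀ k h, h ∉ H → F (k + h) * (starRingEnd ℂ) (F k) = 0 := fun k h hh => by
    rw [hmemH, not_and_or, not_le, not_le] at hh
    rw [hFF]
    rcases hh with hh | hh
    · simp only [hu]
      rw [hcorr M₁ c₁ k.1 h.1 hM₁ hh]
      simp
    · simp only [hu]
      rw [hcorr M₂ c₂ k.2 h.2 hM₂ hh]
      simp
  have hsummable : ∀ (M c θ : ℝ) (h : ℤ), 0 < M →
      Summable fun k : ℤ => ‖(u M c h k : ℂ) * eC (k * θ)‖ := fun M c θ h hM => by
    refine summable_of_ne_finset_zero (s := Finset.Icc ⌈c - R * M⌉ ⌊c + R * M⌋) fun k hk => ?_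
    rw [Finset.mem_Icc, Int.ceil_le, Int.le_floor] at hk
    have : R * M < |(k : ℝ) - c| := by
      by_contra! hcon
      rw [abs_le] at hcon
      exact hk ⟨by linarith, by linarith⟩
    simp [hu, hzero M c k hM this]
  have hterm : ∀ h, ‖∑' k, F (k + h) * (starRingEnd ℂ) (F k)‖ ≤
      K ^ 2 * (M₁ * M₂) * (roundWeight M₁ (2 * √2 * (2 * h.1 + h.2 : ℤ)) *
        roundWeight M₂ (2 * √2 * (h.1 + h.2 : ℤ))) := fun h => by
    simp_rw [hFF]
    rw [tsum_mul_right, ← tsum_mul_tsum_of_summable_norm (hsummable M₁ c₁ _ h.1 hM₁)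
      (hsummable M₂ c₂ _ h.2 hM₂), norm_mul, norm_mul, norm_eC, mul_one]
    refine (mul_le_mul (hK M₁ h₁ c₁ _ h.1) (hK M₂ h₂ c₂ _ h.2) (norm_nonneg _)
      (mul_nonneg (by positivity) (roundWeight_nonneg _ _))).trans_eq ?_
    ring
  rw [← Real.sqrt_mul (by positivity)]
  refine Real.le_sqrt_of_sq_le ?_
  calc _ ≤ _ := sq_norm_tsum_le_sum_norm_correlation F s H hF0 hH0
    _ ≤ _ := sum_le_sum fun h _ => hterm h
    _ ≤ K ^ 2 * (M₁ * M₂) * C := by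
        rw [← mul_sum]
        gcongr
        exact hC M₁ M₂ h₁ h₂ H fun h hh => (hmemH h).1 hh
    _ = K ^ 2 * C * (M₁ * M₂) := by ring
end

section
/- There exists a constant C > 0 such that for all real L, L' ≥ 1: ∑_{ℓ = 1}^{⌊L⌋} 1/(L' ‖√2 ℓ‖² + 1/L') ≤ C (L + L'). -/
/-- The distance from a real number to the nearest integer. -/
noncomputable def distNearestInt (y : ℝ) : ℝ := |y - round y|

/-- `√2` is badly approximable. -/
theorem one_div_four_le_abs_mul_abs_sqrt_two_mul_sub (d p : ℤ) (hd : d ≠ 0) :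
    1 / 4 ≤ |(d : ℝ)| * |Real.sqrt 2 * d - p| := by
  have hsq : Real.sqrt 2 ^ 2 = 2 := Real.sq_sqrt (by norm_num)
  have hne : 2 * d ^ 2 - p ^ 2 ≠ 0 := by
    intro h
    have hd' : (d : ℝ) ≠ 0 := by exact_mod_cast hd
    have h' : (p : ℝ) ^ 2 = 2 * d ^ 2 := by
      have : p ^ 2 = 2 * d ^ 2 := by omega
      exact_mod_cast this
    have h2 : Real.sqrt 2 = |(p : ℝ) / d| := by
      rw [← Real.sqrt_sq_eq_abs, div_pow, h', mul_div_assoc, div_self (by positivity), mul_one]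
    rcases abs_choice ((p : ℝ) / d) with h3 | h3 <;> rw [h3] at h2
    · exact irrational_sqrt_two.ne_rational p d h2
    · exact irrational_sqrt_two.ne_rational (-p) d (by push_cast; rw [h2]; ring)
  have hprod : 1 ≤ |Real.sqrt 2 * d - p| * |Real.sqrt 2 * d + p| := by
    rw [← abs_mul]
    have : (Real.sqrt 2 * d - p) * (Real.sqrt 2 * d + p) = ((2 * d ^ 2 - p ^ 2 : ℤ) : ℝ) := by
      push_cast
      linear_combination (d : ℝ) ^ 2 * hsq
    rw [this]
    exact_mod_cast Int.one_le_abs hne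
  have hd1 : (1 : ℝ) ≤ |(d : ℝ)| := by exact_mod_cast Int.one_le_abs hd
  by_contra! hlt
  have hsmall : |Real.sqrt 2 * d - p| < 1 / 4 := by
    nlinarith [abs_nonneg (Real.sqrt 2 * d - p)]
  have hsqrt : Real.sqrt 2 < 3 / 2 := by
    rw [Real.sqrt_lt' (by norm_num)]
    norm_num
  have hsum : |Real.sqrt 2 * d + p| ≤ 4 * |(d : ℝ)| := by
    have h1 : |Real.sqrt 2 * d + p| ≤ |2 * (Real.sqrt 2 * d)| + |Real.sqrt 2 * d - p| := by
      have := abs_sub (2 * (Real.sqrt 2 * d)) (Real.sqrt 2 * d - p)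
      rwa [show 2 * (Real.sqrt 2 * d) - (Real.sqrt 2 * d - p) = Real.sqrt 2 * d + p by ring]
        at this
    have h2 : |2 * (Real.sqrt 2 * d)| = 2 * Real.sqrt 2 * |(d : ℝ)| := by
      rw [abs_mul, abs_mul, abs_of_nonneg (Real.sqrt_nonneg 2), abs_two, mul_assoc]
    nlinarith
  nlinarith [mul_le_mul_of_nonneg_left hsum (abs_nonneg (Real.sqrt 2 * d - p))]

theorem summable_int_one_div_one_add_sq : Summable fun j : ℤ => 1 / (1 + (j : ℝ) ^ 2) := by
  refine Summable.of_nonneg_of_le (fun j => by positivity) (fun j => ?_)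
    ((Real.summable_one_div_int_pow (p := 2)).2 (by norm_num) |>.add
      (summable_of_hasFiniteSupport (f := fun j : ℤ => if j = 0 then (1 : ℝ) else 0) ?_))
  · by_cases hj : j = 0
    · simp [hj]
    · have : (j : ℝ) ≠ 0 := by exact_mod_cast hj
      simp only [hj, if_false, add_zero]
      gcongr
      linarith
  · refine (Set.finite_singleton (0 : ℤ)).subset fun j hj => ?_
    by_contra h
    simp_all

/-- The pair formed by the block of length `M` containing `ℓ` and the bin of width `1 / (4 * M)`
containing the signed distance from `√2 ℓ` to the nearest integer. -/
noncomputable def blockBin (M : ℝ) (ℓ : ℤ) : ℤ × ℤ :=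
  (⌊ℓ / M⌋, ⌊4 * M * (Real.sqrt 2 * ℓ - round (Real.sqrt 2 * ℓ))⌋)

theorem blockBin_injective {M : ℝ} (hM : 0 < M) : Function.Injective (blockBin M) := by
  intro a b hab
  obtain ⟨h1, h2⟩ := Prod.ext_iff.1 hab
  have h1' := Int.abs_sub_lt_one_of_floor_eq_floor h1
  have h2' := Int.abs_sub_lt_one_of_floor_eq_floor h2
  by_contra hne
  have key := one_div_four_le_abs_mul_abs_sqrt_two_mul_sub (a - b)
    (round (Real.sqrt 2 * a) - round (Real.sqrt 2 * b)) (sub_ne_zero.2 hne)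
  push_cast at key
  rw [← sub_div, abs_div, abs_of_pos hM, div_lt_one hM] at h1'
  rw [← mul_sub, abs_mul, abs_of_pos (by positivity : 0 < 4 * M)] at h2'
  rw [show Real.sqrt 2 * ((a : ℝ) - b)
      - ((round (Real.sqrt 2 * a) : ℝ) - round (Real.sqrt 2 * b))
      = Real.sqrt 2 * a - round (Real.sqrt 2 * a)
        - (Real.sqrt 2 * b - round (Real.sqrt 2 * b)) by ring] at key
  nlinarith [mul_le_mul_of_nonneg_right h1'.le (abs_nonneg
    (Real.sqrt 2 * a - round (Real.sqrt 2 * a) - (Real.sqrt 2 * b - round (Real.sqrt 2 * b))))]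

theorem one_div_mul_sq_add_le {M : ℝ} (hM : 0 < M) (s : ℝ) :
    1 / (M * s ^ 2 + 1 / M) ≤ 48 * M * (1 / (1 + (⌊4 * M * s⌋ : ℝ) ^ 2)) := by
  have h1 := Int.floor_le (4 * M * s)
  have h2 := Int.lt_floor_add_one (4 * M * s)
  set j : ℝ := (⌊4 * M * s⌋ : ℝ)
  have hj : j ^ 2 ≤ 2 * (4 * M * s) ^ 2 + 2 := by
    nlinarith [sq_nonneg (2 * (4 * M * s) - j)]
  rw [show M * s ^ 2 + 1 / M = (M ^ 2 * s ^ 2 + 1) / M by field_simp, one_div_div, mul_one_div,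
    div_le_div_iff₀ (by positivity) (by positivity)]
  nlinarith

/-- There is a constant `C > 0` such that for all reals `L, L' ≥ 1`,
`∑_{ℓ=1}^{⌊L⌋} 1/(L'‖√2 ℓ‖² + 1/L') ≤ C (L + L')`. -/
theorem sum_inverse_small_denominators_sqrt_two :
    ∃ C : ℝ, 0 < C ∧ ∀ L L' : ℝ, 1 ≤ L → 1 ≤ L' →
      ∑ ℓ ∈ Finset.Icc (1 : ℤ) ⌊L⌋,
          1 / (L' * distNearestInt (Real.sqrt 2 * ℓ) ^ 2 + 1 / L')
        ≤ C * (L + L') := by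
  set S : ℝ := ∑' j : ℤ, 1 / (1 + (j : ℝ) ^ 2)
  have hS : 0 < S := summable_int_one_div_one_add_sq.tsum_pos (fun j => by positivity) 0 (by simp)
  refine ⟨48 * S, by positivity, fun L M hL hM => ?_⟩
  have hM0 : 0 < M := by linarith
  let g : ℤ × ℤ → ℝ := fun q => 48 * M * (1 / (1 + (q.2 : ℝ) ^ 2))
  have hg : ∀ q, 0 ≤ g q := fun q => by positivity
  let A := Finset.Icc (1 : ℤ) ⌊L⌋
  let J := A.image fun ℓ => (blockBin M ℓ).2
  have hsub : A.image (blockBin M) ⊆ Finset.Icc 0 ⌊L / M⌋ ×ˢ J := by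
    intro q hq
    obtain ⟨ℓ, hℓ, rfl⟩ := Finset.mem_image.1 hq
    refine Finset.mem_product.2 ⟨?_, Finset.mem_image_of_mem _ hℓ⟩
    obtain ⟨h1, h2⟩ := Finset.mem_Icc.1 hℓ
    have h1' : (1 : ℝ) ≤ ℓ := by exact_mod_cast h1
    have h2' : (ℓ : ℝ) ≤ L := Int.le_floor.1 h2
    exact Finset.mem_Icc.2 ⟨Int.floor_nonneg.2 (by positivity), Int.floor_le_floor (by gcongr)⟩
  have hcard : ((Finset.Icc 0 ⌊L / M⌋).card : ℝ) ≤ L / M + 1 := by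
    have h0 : 0 ≤ ⌊L / M⌋ := Int.floor_nonneg.2 (by positivity)
    have : ((Finset.Icc 0 ⌊L / M⌋).card : ℤ) = ⌊L / M⌋ + 1 := by
      rw [Int.card_Icc]
      omega
    have h2 : ((Finset.Icc 0 ⌊L / M⌋).card : ℝ) = ⌊L / M⌋ + 1 := by exact_mod_cast this
    linarith [Int.floor_le (L / M)]
  have hJ : ∑ j ∈ J, 1 / (1 + (j : ℝ) ^ 2) ≤ S :=
    summable_int_one_div_one_add_sq.sum_le_tsum J fun j _ => by positivity
  calc ∑ ℓ ∈ A, 1 / (M * distNearestInt (Real.sqrt 2 * ℓ) ^ 2 + 1 / M)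
      ≤ ∑ ℓ ∈ A, g (blockBin M ℓ) := by
        refine Finset.sum_le_sum fun ℓ _ => ?_
        rw [distNearestInt, sq_abs]
        exact one_div_mul_sq_add_le hM0 _
    _ = ∑ q ∈ A.image (blockBin M), g q :=
        (Finset.sum_image (blockBin_injective hM0).injOn).symm
    _ ≤ ∑ q ∈ Finset.Icc 0 ⌊L / M⌋ ×ˢ J, g q :=
        Finset.sum_le_sum_of_subset_of_nonneg hsub fun q _ _ => hg q
    _ = (Finset.Icc 0 ⌊L / M⌋).card * (48 * M * ∑ j ∈ J, 1 / (1 + (j : ℝ) ^ 2)) := by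
        simp only [g, Finset.sum_product, Finset.sum_const, nsmul_eq_mul, Finset.mul_sum]
    _ ≤ (L / M + 1) * (48 * M * S) := by gcongr
    _ = 48 * S * (L + M) := by
        field_simp
end
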